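/- For every real number x ≥ 17, the open interval (x/2, x) contains at least two prime numbers. (Equivalently, S_{1,2} ≤ 17; this follows from the Ramanujan prime value R_{1/2,3} = 17, i.e. from the fact that for every x ≥ 17 the interval (x/2, x] contains at least three primes.) -/

import Mathlib

/-- If at most one prime lies in `(n, 2n]`, the central binomial coefficient obeys the bound used in
the proof of Bertrand's postulate: the possible extra prime takes the place of `1` among the numbers
up to `√(2n)`. -/
theorem centralBinom_le_of_unique_bertrand_prime (n q : ℕ) (n_large : 2 < n)
    (unique_prime : ∀ p : ℕ, p.Prime → n < p → p ≤ 2 * n → p = q) :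
    n.centralBinom ≤ (2 * n) ^ Nat.sqrt (2 * n) * 4 ^ (2 * n / 3) := by
  let f p := p ^ n.centralBinom.factorization p
  let S := {p ∈ Finset.range (2 * n + 1) | p.Prime}
  have prod_S : ∏ p ∈ S, f p = n.centralBinom := by
    rw [← n.prod_pow_factorization_centralBinom]
    refine Finset.prod_filter_of_ne fun p _ h => ?_
    contrapose h
    simp [f, Nat.factorization_eq_zero_of_not_prime _ h]
  rw [← prod_S,
    ← Finset.prod_filter_mul_prod_filter_not S (fun p => p ≤ Nat.sqrt (2 * n) ∨ n < p)]
  have sqrt_pos : 0 < Nat.sqrt (2 * n) := Nat.sqrt_pos.2 (by omega)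
  apply mul_le_mul'
  · refine (Finset.prod_le_prod' fun p _ => (?_ : f p ≤ 2 * n)).trans ?_
    · exact Nat.pow_factorization_choose_le (by omega)
    rw [Finset.prod_const]
    refine Nat.pow_le_pow_right (by omega) ?_
    have subset : S.filter (fun p => p ≤ Nat.sqrt (2 * n) ∨ n < p) ⊆
        insert q (Finset.Icc 2 (Nat.sqrt (2 * n))) := by
      intro p hp
      simp only [S, Finset.mem_filter, Finset.mem_range] at hp
      obtain ⟨⟨hp_le, hp_prime⟩, h | h⟩ := hp
      · exact Finset.mem_insert_of_mem (Finset.mem_Icc.2 ⟨hp_prime.two_le, h⟩)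
      · exact Finset.mem_insert.2 (.inl (unique_prime p hp_prime h (by omega)))
    refine (Finset.card_le_card subset).trans ((Finset.card_insert_le _ _).trans ?_)
    rw [Nat.card_Icc]
    omega
  · refine le_trans ?_ (primorial_le_four_pow (2 * n / 3))
    rw [primorial]
    calc
      ∏ p ∈ S.filter (fun p => ¬(p ≤ Nat.sqrt (2 * n) ∨ n < p)), f p
      _ ≤ ∏ p ∈ S.filter (fun p => ¬(p ≤ Nat.sqrt (2 * n) ∨ n < p)),
            if p ≤ 2 * n / 3 then p else 1 := by
        refine Finset.prod_le_prod' fun p hp => ?_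
        simp only [S, Finset.mem_filter, Finset.mem_range, not_or, not_le, not_lt] at hp
        obtain ⟨⟨-, hp_prime⟩, hp_sqrt, hp_n⟩ := hp
        split_ifs with h
        · refine (Nat.pow_le_pow_right hp_prime.pos ?_).trans (pow_one p).le
          exact Nat.factorization_choose_le_one (Nat.sqrt_lt'.mp hp_sqrt)
        · simp [f, Nat.factorization_centralBinom_of_two_mul_self_lt_three_mul n_large hp_n
            (by omega)]
      _ ≤ _ := by
        rw [← Finset.prod_filter]
        refine Finset.prod_le_prod_of_subset_of_one_le' (fun p hp => ?_) fun p hp _ => ?_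
        · simp only [S, Finset.mem_filter, Finset.mem_range] at hp ⊢
          exact ⟨by omega, hp.1.1.2⟩
        · exact (Finset.mem_filter.1 hp).2.pos

/-- For `n ≥ 8` there are two distinct primes in `(n, 2n]`. -/
theorem exists_two_primes_lt_and_le_two_mul (n : ℕ) (hn : 8 ≤ n) :
    ∃ p q : ℕ, p.Prime ∧ q.Prime ∧ p < q ∧ n < p ∧ q ≤ 2 * n := by
  rcases lt_or_ge n 512 with h | h
  · have cover : n < 11 ∨ 10 ≤ n ∧ n < 17 ∨ 16 ≤ n ∧ n < 29 ∨ 27 ≤ n ∧ n < 47 ∨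
        45 ≤ n ∧ n < 83 ∨ 82 ≤ n ∧ n < 157 ∨ 157 ≤ n ∧ n < 311 ∨ 310 ≤ n := by omega
    rcases cover with h | h | h | h | h | h | h | h
    · exact ⟨11, 13, by norm_num, by norm_num, by norm_num, by omega, by omega⟩
    · exact ⟨17, 19, by norm_num, by norm_num, by norm_num, by omega, by omega⟩
    · exact ⟨29, 31, by norm_num, by norm_num, by norm_num, by omega, by omega⟩
    · exact ⟨47, 53, by norm_num, by norm_num, by norm_num, by omega, by omega⟩
    · exact ⟨83, 89, by norm_num, by norm_num, by norm_num, by omega, by omega⟩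
    · exact ⟨157, 163, by norm_num, by norm_num, by norm_num, by omega, by omega⟩
    · exact ⟨311, 313, by norm_num, by norm_num, by norm_num, by omega, by omega⟩
    · exact ⟨617, 619, by norm_num, by norm_num, by norm_num, by omega, by omega⟩
  · obtain ⟨q, hq, hnq, hq_le⟩ := Nat.exists_prime_lt_and_le_two_mul n (by omega)
    by_cases unique_prime : ∀ p : ℕ, p.Prime → n < p → p ≤ 2 * n → p = q
    · have lower := Nat.four_pow_lt_mul_centralBinom n (by omega)
      have upper := centralBinom_le_of_unique_bertrand_prime n q (by omega) unique_prime
      have main := bertrand_main_inequality h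
      rw [mul_assoc] at main
      exact absurd ((lower.trans_le (Nat.mul_le_mul_left n upper)).trans_le main) (lt_irrefl _)
    · push Not at unique_prime
      obtain ⟨p, hp, hnp, hp_le, hpq⟩ := unique_prime
      rcases hpq.lt_or_gt with hlt | hlt
      · exact ⟨p, q, hp, hq, hlt, hnp, hq_le⟩
      · exact ⟨q, p, hq, hp, hlt, hnq, hp_le⟩

/-- for every real `x ≥ 17`, the open interval `(x/2, x)` contains at
least two primes. -/
theorem stmt10 (x : ℝ) (hx : 17 ≤ x) :
    2 ≤ {p : ℕ | p.Prime ∧ (p : ℝ) ∈ Set.Ioo (x / 2) x}.ncard := by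
  have x_le := Nat.le_ceil x
  have ceil_ge : 17 ≤ ⌈x⌉₊ := by exact_mod_cast hx.trans x_le
  have mem_of_bounds : ∀ p : ℕ, p.Prime → ⌈x⌉₊ / 2 < p → p ≤ 2 * (⌈x⌉₊ / 2) →
      p ∈ {p : ℕ | p.Prime ∧ (p : ℝ) ∈ Set.Ioo (x / 2) x} := by
    intro p hp hlt hle
    have hp_ne : p ≠ 2 * (⌈x⌉₊ / 2) := by
      intro h
      have := (Nat.prime_dvd_prime_iff_eq Nat.prime_two hp).1 ⟨_, h⟩
      omega
    have ceil_lt : (⌈x⌉₊ : ℝ) < 2 * p := by exact_mod_cast (by omega : ⌈x⌉₊ < 2 * p)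
    exact ⟨hp, by linarith, Nat.lt_ceil.1 (by omega)⟩
  obtain ⟨p, q, hp, hq, hpq, hlt, hle⟩ :=
    exists_two_primes_lt_and_le_two_mul (⌈x⌉₊ / 2) (by omega)
  have finite : {p : ℕ | p.Prime ∧ (p : ℝ) ∈ Set.Ioo (x / 2) x}.Finite :=
    (Set.finite_lt_nat ⌈x⌉₊).subset fun p hp => Nat.lt_ceil.2 hp.2.2
  rw [← Set.ncard_pair hpq.ne]
  refine Set.ncard_le_ncard (Set.pair_subset ?_ ?_) finite
  · exact mem_of_bounds p hp hlt (by omega)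
  · exact mem_of_bounds q hq (by omega) hle
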